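/- Let G be a finite connected simple graph of diameter 3 with at least one minimal vertex separator of cardinality 2. If the second largest distance eigenvalue of G satisfies λ2(G) < −1/2, then G is isomorphic to a connected induced subgraph of the graph Pt_1 or of a triple block graph Pt_2(p,q) for some integers p, q ≥ 2. -/

import Mathlib

open Polynomial SimpleGraph Sum

noncomputable section

/-- The distance matrix of a graph, with real entries. -/
def distMatrix {V : Type*} [Fintype V] (G : SimpleGraph V) : Matrix V V ℝ :=
  Matrix.of fun u v => (G.dist u v : ℝ)

/-- The second largest distance eigenvalue: the eigenvalues of the distance matrix
(the roots of its characteristic polynomial, with multiplicity) are sorted in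
increasing order, and we take the one at position `card V - 2`. -/
def lambda2 {V : Type*} [Fintype V] [DecidableEq V] (G : SimpleGraph V) : ℝ :=
  ((distMatrix G).charpoly.roots.sort (· ≤ ·)).getD (Fintype.card V - 2) 0

/-- The diameter of a finite graph. -/
def graphDiam {V : Type*} [Fintype V] (G : SimpleGraph V) : ℕ :=
  Finset.univ.sup fun p : V × V => G.dist p.1 p.2

/-- A graph is chordal if every cycle of length at least 4 has a chord. -/
def IsChordal {V : Type*} (G : SimpleGraph V) : Prop :=
  ∀ (v : V) (c : G.Walk v v), c.IsCycle → 4 ≤ c.length →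
    ∃ u w : V, u ∈ c.support ∧ w ∈ c.support ∧ G.Adj u w ∧ s(u, w) ∉ c.edges

/-- Ptolemaic graph: the Ptolemy inequality for the graph distance. -/
def IsPtolemaic {V : Type*} (G : SimpleGraph V) : Prop :=
  ∀ u v w x : V,
    G.dist u v * G.dist w x ≤ G.dist u w * G.dist v x + G.dist u x * G.dist v w

/-- `S` is a `uv`-separator: `u, v ∉ S` and every walk from `u` to `v` meets `S`. -/
def IsUVSeparator {V : Type*} (G : SimpleGraph V) (S : Finset V) (u v : V) : Prop :=
  u ∉ S ∧ v ∉ S ∧ ∀ w : G.Walk u v, ∃ x ∈ w.support, x ∈ S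

/-- `S` is a minimal vertex separator: a minimal `uv`-separator for some pair of
distinct non-adjacent vertices `u, v`. -/
def IsMinimalVertexSeparator {V : Type*} (G : SimpleGraph V) (S : Finset V) : Prop :=
  ∃ u v : V, u ≠ v ∧ ¬ G.Adj u v ∧ IsUVSeparator G S u v ∧
    ∀ T : Finset V, T ⊂ S → ¬ IsUVSeparator G T u v

/-- A connected component `K` of `G − S` is full if every vertex of `S` has a
neighbour in `K`. -/
def IsFullComponent {V : Type*} (G : SimpleGraph V) (S : Finset V)
    (K : (G.induce ((S : Set V)ᶜ)).ConnectedComponent) : Prop :=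
  ∀ a ∈ S, ∃ x : ((S : Set V)ᶜ : Set V),
    (G.induce ((S : Set V)ᶜ)).connectedComponentMk x = K ∧ G.Adj a ↑x

/-- The join `G ⊕ H` of two vertex-disjoint graphs. -/
def graphJoin {α β : Type*} (G : SimpleGraph α) (H : SimpleGraph β) :
    SimpleGraph (α ⊕ β) :=
  SimpleGraph.fromRel fun x y =>
    (∃ a b, x = Sum.inl a ∧ y = Sum.inl b ∧ G.Adj a b) ∨
    (∃ a b, x = Sum.inr a ∧ y = Sum.inr b ∧ H.Adj a b) ∨
    (x.isLeft ∧ y.isRight)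

/-- The disjoint union of two vertex-disjoint graphs. -/
def graphSum {α β : Type*} (G : SimpleGraph α) (H : SimpleGraph β) :
    SimpleGraph (α ⊕ β) :=
  SimpleGraph.fromRel fun x y =>
    (∃ a b, x = Sum.inl a ∧ y = Sum.inl b ∧ G.Adj a b) ∨
    (∃ a b, x = Sum.inr a ∧ y = Sum.inr b ∧ H.Adj a b)

/-- `p` disjoint copies of the complete graph `K_r`. -/
def cliqueCopies (p r : ℕ) : SimpleGraph (Fin p × Fin r) :=
  SimpleGraph.fromRel fun x y => x.1 = y.1

/-- `q` disjoint copies of `K_1 ⊕ (K_1 ∪ K_2)` (the paw graph): in each copy,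
vertex 0 is universal, vertex 1 is otherwise isolated, vertices 2,3 form a `K_2`. -/
def pawCopies (q : ℕ) : SimpleGraph (Fin q × Fin 4) :=
  SimpleGraph.fromRel fun x y => x.1 = y.1 ∧ (x.2 = 0 ∨ (x.2 = 2 ∧ y.2 = 3))

/-- `s` disjoint copies of the path `P_3`. -/
def path3Copies (s : ℕ) : SimpleGraph (Fin s × Fin 3) :=
  SimpleGraph.fromRel fun x y => x.1 = y.1 ∧ ((x.2 = 0 ∧ y.2 = 1) ∨ (x.2 = 1 ∧ y.2 = 2))

/-- The disjoint union `p_1 K_{r_1} ∪ ⋯ ∪ p_k K_{r_k}`. -/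
def multiCliques (k : ℕ) (p r : Fin k → ℕ) :
    SimpleGraph ((i : Fin k) × (Fin (p i) × Fin (r i))) :=
  SimpleGraph.fromRel fun x y =>
    (⟨x.1, x.2.1⟩ : (i : Fin k) × Fin (p i)) = ⟨y.1, y.2.1⟩

/-- The relaxed block star
`K_1 ⊕ ((p_1 K_{r_1} ∪ ⋯ ∪ p_k K_{r_k}) ∪ q (K_1 ⊕ (K_1 ∪ K_2)) ∪ s P_3)`. -/
def relaxedBlockStar (k : ℕ) (p r : Fin k → ℕ) (q s : ℕ) :
    SimpleGraph (Unit ⊕ (((i : Fin k) × (Fin (p i) × Fin (r i))) ⊕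
      ((Fin q × Fin 4) ⊕ (Fin s × Fin 3)))) :=
  graphJoin (⊤ : SimpleGraph Unit)
    (graphSum (multiCliques k p r) (graphSum (pawCopies q) (path3Copies s)))

/-- The graph `G(r,p,q) = K_1 ⊕ (p K_r ∪ q (K_1 ⊕ (K_1 ∪ K_2)))`. -/
def Grpq (r p q : ℕ) : SimpleGraph (Unit ⊕ ((Fin p × Fin r) ⊕ (Fin q × Fin 4))) :=
  graphJoin (⊤ : SimpleGraph Unit) (graphSum (cliqueCopies p r) (pawCopies q))

/-- The full house graph `K_2 ⊕ (K_1 ∪ K_2)`: vertices 0,1 form the join-`K_2`,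
vertex 2 is the `K_1`, vertices 3,4 form the `K_2`. -/
def fullHouse : SimpleGraph (Fin 5) :=
  SimpleGraph.fromRel fun x y => x = 0 ∨ x = 1 ∨ (x = 3 ∧ y = 4)

/-- The diamond graph: `K_4` minus an edge. -/
def diamondGraph : SimpleGraph (Fin 4) :=
  SimpleGraph.fromRel fun x y => x = 0 ∨ x = 1

/-- The path on four vertices. -/
def path4 : SimpleGraph (Fin 4) :=
  SimpleGraph.fromRel fun x y => (x : ℕ) + 1 = (y : ℕ)

/-- The cycle on four vertices. -/
def cycle4 : SimpleGraph (Fin 4) :=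
  SimpleGraph.fromRel fun x y => x + 1 = y

/-- The triple block graph `Pt_2(p,q)`: a full house (on `Fin 5`, with the
join-`K_2` being vertices `a = 0`, `b = 1`) together with `p - 1` further vertices
forming with `a` a clique `K_p` and `q - 1` further vertices forming with `b`
a clique `K_q`. -/
def Pt2Graph (p q : ℕ) : SimpleGraph (Fin 5 ⊕ (Fin (p - 1) ⊕ Fin (q - 1))) :=
  SimpleGraph.fromRel fun x y =>
    match x, y with
    | Sum.inl a, Sum.inl b => a = 0 ∨ a = 1 ∨ (a = 3 ∧ b = 4)
    | Sum.inl a, Sum.inr (Sum.inl _) => a = 0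
    | Sum.inl a, Sum.inr (Sum.inr _) => a = 1
    | Sum.inr (Sum.inl _), Sum.inr (Sum.inl _) => True
    | Sum.inr (Sum.inr _), Sum.inr (Sum.inr _) => True
    | _, _ => False

/-- The nine-vertex graph `Pt_1`: a full house (vertices 0,…,4, join-`K_2` being
`a = 0`, `b = 1`, `K_2` being 3,4), a vertex 5 adjacent only to `a`, a vertex 6
adjacent only to `b`, and vertices 7,8 adjacent to each other and to `b`. -/
def Pt1Graph : SimpleGraph (Fin 9) :=
  SimpleGraph.fromRel fun x y =>
    (x = 0 ∧ (y = 1 ∨ y = 2 ∨ y = 3 ∨ y = 4 ∨ y = 5)) ∨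
    (x = 1 ∧ (y = 2 ∨ y = 3 ∨ y = 4 ∨ y = 6 ∨ y = 7 ∨ y = 8)) ∨
    (x = 3 ∧ y = 4) ∨ (x = 7 ∧ y = 8)

/-- `G` contains an induced subgraph isomorphic to `H`. -/
def HasInducedSubgraph {V W : Type*} (G : SimpleGraph V) (H : SimpleGraph W) : Prop :=
  ∃ s : Set V, Nonempty ((G.induce s) ≃g H)

/-- `G` is isomorphic to a connected induced subgraph of `H`. -/
def IsoToConnectedInducedSubgraph {V W : Type*} (G : SimpleGraph V)
    (H : SimpleGraph W) : Prop :=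
  ∃ s : Set W, (H.induce s).Connected ∧ Nonempty (G ≃g (H.induce s))

/-- A vertex is simplicial if its neighbourhood is a clique. -/
def IsSimplicial {V : Type*} (G : SimpleGraph V) (v : V) : Prop :=
  G.IsClique (G.neighborSet v)

/-- The quintic polynomial `f(r,p,q,x)`. -/
def fpoly (r p q : ℕ) : Polynomial ℝ :=
  X ^ 5 - C (8 * (q : ℝ) + 2 * (r : ℝ) * (p : ℝ) - (r : ℝ) - 8) * X ^ 4
    - C ((8 * (r : ℝ) + 36) * (q : ℝ) + 15 * (r : ℝ) * (p : ℝ) - 7 * (r : ℝ) - 20) * X ^ 3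
    - C ((28 * (r : ℝ) + 52) * (q : ℝ) + 33 * (r : ℝ) * (p : ℝ) - 13 * (r : ℝ) - 18) * X ^ 2
    - C ((24 * (r : ℝ) + 30) * (q : ℝ) + 23 * (r : ℝ) * (p : ℝ) - 5 * (r : ℝ) - 5) * X
    - C ((6 * (r : ℝ) + 6) * (q : ℝ) + 5 * (r : ℝ) * (p : ℝ))

end

/-- The entry of `2 D(G) + I` at a pair of vertices at distance `n`. -/
def wt (n : ℕ) : ℤ := 2 * n + if n = 0 then 1 else 0

/-- The `u`-th coordinate of `(2 D(G) + I) y`, where `y` is the formal combination `l`. -/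
noncomputable def distSum {V : Type*} (G : SimpleGraph V) (u : V) : List (V × ℤ) → ℤ
  | [] => 0
  | p :: l => p.2 * wt (G.dist u p.1) + distSum G u l

/-- The quadratic form of `2 D(G) + I` at the formal combination `l` of vertices. -/
noncomputable def distForm {V : Type*} (G : SimpleGraph V) : List (V × ℤ) → ℤ
  | [] => 0
  | p :: l => p.2 ^ 2 + 2 * p.2 * distSum G p.1 l + distForm G l

/-- The reversed Cauchy–Schwarz inequality for `2 D(G) + I` at pairs consisting of a vertex and
an integer combination of vertices. -/
def IsDistLorentzian {V : Type*} (G : SimpleGraph V) : Prop :=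
  ∀ (u : V) (l : List (V × ℤ)), distForm G l ≤ distSum G u l ^ 2

section Spectral

open Matrix

lemma distMatrix_isHermitian {V : Type*} [Fintype V] (G : SimpleGraph V) :
    (distMatrix G).IsHermitian := by
  ext u v
  simp [distMatrix, SimpleGraph.dist_comm]

lemma List.countP_le_one_of_getD_lt (L : List ℝ) (hL : L.Pairwise (· ≤ ·)) (c : ℝ)
    (h2 : 2 ≤ L.length) (h : L.getD (L.length - 2) 0 < c) :
    L.countP (fun x => decide (c ≤ x)) ≤ 1 := by
  rw [← List.take_append_drop (L.length - 1) L, List.countP_append]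
  have hdrop : (L.drop (L.length - 1)).countP (fun x => decide (c ≤ x)) ≤ 1 :=
    List.countP_le_length.trans (by rw [List.length_drop]; omega)
  have htake : (L.take (L.length - 1)).countP (fun x => decide (c ≤ x)) = 0 := by
    rw [List.countP_eq_zero]
    intro x hx
    obtain ⟨i, hi, rfl⟩ := List.mem_iff_getElem.1 hx
    rw [List.length_take] at hi
    rw [List.getD_eq_getElem _ _ (by omega)] at h
    have hle : L[i]'(by omega) ≤ L[L.length - 2]'(by omega) :=
      hL.rel_get_of_le (a := ⟨i, by omega⟩) (b := ⟨L.length - 2, by omega⟩)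
        (by rw [Fin.mk_le_mk]; omega)
    simpa using hle.trans_lt h
  omega

lemma eigenvalues_eq_of_lambda2_lt {V : Type*} [Fintype V] [DecidableEq V] (G : SimpleGraph V)
    (hV : 2 ≤ Fintype.card V) {c : ℝ} (h : lambda2 G < c) {i j : V}
    (hi : c ≤ (distMatrix_isHermitian G).eigenvalues i)
    (hj : c ≤ (distMatrix_isHermitian G).eigenvalues j) : i = j := by
  set hD := distMatrix_isHermitian G
  have hroots : (distMatrix G).charpoly.roots = Finset.univ.val.map hD.eigenvalues := by
    rw [hD.roots_charpoly_eq_eigenvalues]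
    simp
  set L := (distMatrix G).charpoly.roots.sort (· ≤ ·) with hLdef
  have hlen : L.length = Fintype.card V := by
    rw [hLdef, Multiset.length_sort, hroots]
    simp
  have hcount := List.countP_le_one_of_getD_lt L (Multiset.pairwise_sort _ _) c (by omega)
    (by rw [hlen]; exact h)
  have hcount' : (Finset.univ.filter fun i => c ≤ hD.eigenvalues i).card ≤ 1 := by
    rw [← Multiset.coe_countP, hLdef, Multiset.sort_eq, hroots, Multiset.countP_map] at hcount
    simpa [Finset.card, Finset.filter] using hcount
  exact Finset.card_le_one.1 hcount' i (by simpa using hi) j (by simpa using hj)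

lemma dotProduct_mulVec_eq_sum_eigenvalues {n : Type*} [Fintype n] [DecidableEq n]
    {A : Matrix n n ℝ} (hA : A.IsHermitian) (z : n → ℝ) :
    z ⬝ᵥ A *ᵥ z = ∑ i, hA.eigenvalues i * (⇑(hA.eigenvectorBasis i) ⬝ᵥ z) ^ 2 := by
  have key := hA.eigenvectorBasis.sum_inner_mul_inner (WithLp.toLp 2 z) (WithLp.toLp 2 (A *ᵥ z))
  simp only [EuclideanSpace.inner_eq_star_dotProduct, star_trivial] at key
  rw [dotProduct_comm, ← key]
  refine Finset.sum_congr rfl fun i _ => ?_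
  have : A *ᵥ z ⬝ᵥ ⇑(hA.eigenvectorBasis i)
      = hA.eigenvalues i * (⇑(hA.eigenvectorBasis i) ⬝ᵥ z) := by
    have hAt : Aᵀ = A := (conjTranspose_eq_transpose_of_trivial A).symm.trans hA
    rw [dotProduct_comm, dotProduct_mulVec, ← mulVec_transpose, hAt,
      hA.mulVec_eigenvectorBasis, smul_dotProduct, smul_eq_mul]
  rw [this]
  ring

lemma sum_sq_dotProduct_eigenvectorBasis {n : Type*} [Fintype n] [DecidableEq n]
    {A : Matrix n n ℝ} (hA : A.IsHermitian) (z : n → ℝ) :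
    z ⬝ᵥ z = ∑ i, (⇑(hA.eigenvectorBasis i) ⬝ᵥ z) ^ 2 := by
  have key := hA.eigenvectorBasis.sum_inner_mul_inner (WithLp.toLp 2 z) (WithLp.toLp 2 z)
  simp only [EuclideanSpace.inner_eq_star_dotProduct, star_trivial] at key
  rw [← key]
  exact Finset.sum_congr rfl fun i _ => by rw [dotProduct_comm z]; ring

/-- If all eigenvalues of `A` but one are at most `c`, then `A - c` satisfies the reversed
Cauchy–Schwarz inequality at vectors on which it is positive. -/
lemma reversed_cauchySchwarz {n : Type*} [Fintype n] [DecidableEq n]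
    {A : Matrix n n ℝ} (hA : A.IsHermitian) {c : ℝ} {i₀ : n}
    (h : ∀ i, i ≠ i₀ → hA.eigenvalues i ≤ c) {x : n → ℝ}
    (hx : 0 < x ⬝ᵥ A *ᵥ x - c * (x ⬝ᵥ x)) (y : n → ℝ) :
    (x ⬝ᵥ A *ᵥ x - c * (x ⬝ᵥ x)) * (y ⬝ᵥ A *ᵥ y - c * (y ⬝ᵥ y))
      ≤ (x ⬝ᵥ A *ᵥ y - c * (x ⬝ᵥ y)) ^ 2 := by
  have hneg : ∀ z : n → ℝ, ⇑(hA.eigenvectorBasis i₀) ⬝ᵥ z = 0 →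
      z ⬝ᵥ A *ᵥ z - c * (z ⬝ᵥ z) ≤ 0 := by
    intro z hz
    rw [dotProduct_mulVec_eq_sum_eigenvalues hA, sum_sq_dotProduct_eigenvectorBasis hA,
      Finset.mul_sum, ← Finset.sum_sub_distrib]
    refine Finset.sum_nonpos fun i _ => ?_
    by_cases hi : i = i₀
    · simp [hi, hz]
    · nlinarith [h i hi, sq_nonneg (⇑(hA.eigenvectorBasis i) ⬝ᵥ z)]
  have hsymm : y ⬝ᵥ A *ᵥ x = x ⬝ᵥ A *ᵥ y := by
    have hAt : Aᵀ = A := (conjTranspose_eq_transpose_of_trivial A).symm.trans hA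
    rw [dotProduct_mulVec, ← mulVec_transpose, hAt, dotProduct_comm]
  set s := ⇑(hA.eigenvectorBasis i₀) ⬝ᵥ y with hs
  set t := ⇑(hA.eigenvectorBasis i₀) ⬝ᵥ x with ht
  have ht0 : t ≠ 0 := fun h0 => absurd (hneg x h0) (not_le.2 hx)
  have hz := hneg (s • x - t • y) (by
    rw [dotProduct_sub, dotProduct_smul, dotProduct_smul, ← hs, ← ht, smul_eq_mul, smul_eq_mul]
    ring)
  simp only [mulVec_sub, mulVec_smul, dotProduct_sub, sub_dotProduct, smul_dotProduct,
    dotProduct_smul, smul_eq_mul, hsymm, dotProduct_comm y x] at hz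
  set a := x ⬝ᵥ A *ᵥ x - c * (x ⬝ᵥ x) with ha
  set b := x ⬝ᵥ A *ᵥ y - c * (x ⬝ᵥ y) with hb
  set d := y ⬝ᵥ A *ᵥ y - c * (y ⬝ᵥ y) with hd
  have hz' : s ^ 2 * a - 2 * s * t * b + t ^ 2 * d ≤ 0 := by
    rw [ha, hb, hd]; linarith
  have htt : 0 < t ^ 2 := by positivity
  have : t ^ 2 * (a * d) ≤ t ^ 2 * b ^ 2 := by
    nlinarith [sq_nonneg (s * a - t * b), mul_le_mul_of_nonneg_left hz' hx.le]
  exact le_of_mul_le_mul_left this htt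

lemma isDistLorentzian_of_lambda2_lt {V : Type*} [Fintype V] [DecidableEq V] (G : SimpleGraph V)
    (hconn : G.Connected) (hV : 2 ≤ Fintype.card V) (h : lambda2 G < -1/2) :
    IsDistLorentzian G := by
  set hD := distMatrix_isHermitian G
  obtain ⟨i₀, hi₀⟩ : ∃ i₀, ∀ i, i ≠ i₀ → hD.eigenvalues i ≤ -1/2 := by
    by_cases hex : ∃ i₀, -1/2 ≤ hD.eigenvalues i₀
    · obtain ⟨i₀, h₀⟩ := hex
      refine ⟨i₀, fun i hi => ?_⟩
      by_contra hlt
      exact hi (eigenvalues_eq_of_lambda2_lt G hV h (not_le.1 hlt).le h₀)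
    · push Not at hex
      obtain ⟨v⟩ := hconn.nonempty
      exact ⟨v, fun i _ => (hex i).le⟩
  let comb : List (V × ℤ) → V → ℝ := fun l => (l.map fun p => (p.2 : ℝ) • Pi.single p.1 1).sum
  let B : (V → ℝ) → (V → ℝ) → ℝ := fun x y => x ⬝ᵥ distMatrix G *ᵥ y - (-1/2) * (x ⬝ᵥ y)
  have hB : ∀ u v : V, 2 * B (Pi.single u 1) (Pi.single v 1) = (wt (G.dist u v) : ℝ) := by
    intro u v
    by_cases huv : u = v
    · simp [B, wt, huv, distMatrix]
      norm_num
    · simp [B, wt, huv, distMatrix, hconn.dist_eq_zero_iff]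
  have hBsum : ∀ (u : V) (l : List (V × ℤ)),
      2 * B (Pi.single u 1) (comb l) = (distSum G u l : ℝ) := by
    intro u l
    induction l with
    | nil => simp [B, comb, distSum]
    | cons p l ih =>
      have : comb (p :: l) = (p.2 : ℝ) • Pi.single p.1 1 + comb l := rfl
      rw [this, distSum]
      push_cast
      rw [← ih, ← hB]
      simp only [B, mulVec_add, mulVec_smul, dotProduct_add, dotProduct_smul, smul_eq_mul]
      ring
  have hBsymm : ∀ x y, B x y = B y x := by
    intro x y
    have hAt : (distMatrix G)ᵀ = distMatrix G :=
      (conjTranspose_eq_transpose_of_trivial _).symm.trans hD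
    simp only [B]
    rw [dotProduct_mulVec, ← mulVec_transpose, hAt, dotProduct_comm, dotProduct_comm x y]
  have hBform : ∀ l : List (V × ℤ), 2 * B (comb l) (comb l) = (distForm G l : ℝ) := by
    intro l
    induction l with
    | nil => simp [B, comb, distForm]
    | cons p l ih =>
      have : comb (p :: l) = (p.2 : ℝ) • Pi.single p.1 1 + comb l := rfl
      rw [this, distForm]
      push_cast
      have h1 := hBsum p.1 l
      have h2 := hB p.1 p.1
      have h3 := hBsymm (comb l) (Pi.single p.1 1)
      simp only [SimpleGraph.dist_self, wt] at h2
      rw [← ih, ← h1]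
      have h4 : B ((p.2 : ℝ) • Pi.single p.1 1 + comb l) ((p.2 : ℝ) • Pi.single p.1 1 + comb l)
          = (p.2 : ℝ) ^ 2 * B (Pi.single p.1 1) (Pi.single p.1 1)
            + p.2 * B (Pi.single p.1 1) (comb l) + p.2 * B (comb l) (Pi.single p.1 1)
            + B (comb l) (comb l) := by
        simp only [B, mulVec_add, mulVec_smul, dotProduct_add, dotProduct_smul, add_dotProduct,
          smul_dotProduct, smul_eq_mul]
        ring
      rw [h4, h3]
      push_cast at h2
      linear_combination (p.2 : ℝ) ^ 2 * h2
  intro u l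
  have huu : 2 * B (Pi.single u 1) (Pi.single u 1) = 1 := by
    rw [hB]; simp [wt]
  have key : B (Pi.single u 1) (Pi.single u 1) * B (comb l) (comb l)
      ≤ B (Pi.single u 1) (comb l) ^ 2 :=
    reversed_cauchySchwarz hD hi₀ (show 0 < B _ _ by linarith) (comb l)
  have : (distForm G l : ℝ) ≤ (distSum G u l : ℝ) ^ 2 := by
    rw [← hBform, ← hBsum]
    nlinarith
  exact_mod_cast this

end Spectral

lemma dist_of_adj {V : Type*} {G : SimpleGraph V} {x y : V} (h : G.Adj x y) : G.dist x y = 1 :=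
  SimpleGraph.dist_eq_one_iff_adj.2 h

/-- The consequences of the hypotheses on `G` that the structural arguments use: `G` is connected,
has diameter at most 3 and all but one eigenvalue of `2 D(G) + I` are negative. -/
structure LorentzianDiamThree {V : Type*} (G : SimpleGraph V) : Prop where
  connected : G.Connected
  dist_le (x y : V) : G.dist x y ≤ 3
  lorentzian : IsDistLorentzian G

namespace LorentzianDiamThree

variable {V : Type*} {G : SimpleGraph V} (hG : LorentzianDiamThree G)

include hG

lemma two_or_three {x y : V} (hne : x ≠ y) (h : ¬G.Adj x y) :
    G.dist x y = 2 ∨ G.dist x y = 3 := by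
  have h0 := hG.connected.dist_eq_zero_iff (u := x) (v := y)
  have h1 := SimpleGraph.dist_eq_one_iff_adj (G := G) (u := x) (v := y)
  have h3 := hG.dist_le x y
  have : G.dist x y ≠ 0 := fun h => hne (h0.1 h)
  have : G.dist x y ≠ 1 := fun h' => h (h1.1 h')
  omega

lemma one_or_two_or_three {x y : V} (hne : x ≠ y) :
    G.dist x y = 1 ∨ G.dist x y = 2 ∨ G.dist x y = 3 := by
  by_cases h : G.Adj x y
  · exact Or.inl (SimpleGraph.dist_eq_one_iff_adj.2 h)
  · exact Or.inr (hG.two_or_three hne h)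

lemma eq_two {x y : V} (m : V) (hne : x ≠ y) (h : ¬G.Adj x y) (hx : G.Adj x m) (hy : G.Adj m y) :
    G.dist x y = 2 := by
  have := hG.connected.dist_triangle (u := x) (v := m) (w := y)
  rw [dist_of_adj hx, dist_of_adj hy] at this
  have := hG.two_or_three hne h
  omega

lemma no_cycle4 {a b c d : V} (hab : a ≠ b) (hab' : ¬G.Adj a b) (hcd : c ≠ d)
    (hcd' : ¬G.Adj c d) (hac : G.Adj a c) (hbc : G.Adj b c) (had : G.Adj a d) (hbd : G.Adj b d) :
    False := by
  have h1 := hG.eq_two c hab hab' hac hbc.symm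
  have h2 := hG.eq_two a hcd hcd' hac.symm had
  have key := hG.lorentzian a [(b, 1), (c, -1), (d, -1)]
  simp [distForm, distSum, wt, h1, h2, dist_of_adj hac, dist_of_adj hbc, dist_of_adj had,
    dist_of_adj hbd] at key

/-- Two vertices at distance 2 have no neighbours avoiding a common neighbour of theirs. -/
lemma no_escape_two {a b w x y : V} (hab : a ≠ b) (hab' : ¬G.Adj a b) (haw : G.Adj a w)
    (hbw : G.Adj b w) (hax : G.Adj a x) (hby : G.Adj b y) (hwx : w ≠ x) (hwx' : ¬G.Adj w x)
    (hwy : w ≠ y) (hwy' : ¬G.Adj w y) : False := by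
  by_cases hbx : G.Adj b x
  · exact hG.no_cycle4 hab hab' hwx hwx' haw hbw hax hbx
  by_cases hay : G.Adj a y
  · exact hG.no_cycle4 hab hab' hwy hwy' haw hbw hay hby
  have h1 := hG.eq_two w hab hab' haw hbw.symm
  have h2 := hG.eq_two a hwx hwx' haw.symm hax
  have h3 := hG.eq_two b hwy hwy' hbw.symm hby
  have h4 := hG.two_or_three (x := a) (y := y) (by rintro rfl; exact hab' hby.symm) hay
  have h5 := hG.two_or_three (x := b) (y := x) (by rintro rfl; exact hab' hax) hbx
  have h6 := hG.one_or_two_or_three (x := x) (y := y) (by rintro rfl; exact hbx hby)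
  have key1 := hG.lorentzian a [(b, 1), (w, -2), (x, -1)]
  have key2 := hG.lorentzian b [(a, 2), (w, 1), (x, -2), (y, 2)]
  have key3 := hG.lorentzian b [(a, 1), (w, -2), (y, -1)]
  simp only [distForm, distSum, G.dist_comm (u := b) (v := a), h1, h2, h3, dist_of_adj haw,
    dist_of_adj hbw, dist_of_adj hax, dist_of_adj hby] at key1 key2 key3
  rcases h4 with h4 | h4 <;> rcases h5 with h5 | h5 <;> rcases h6 with h6 | h6 | h6 <;>
    simp [wt, h4, h5, h6] at key1 key2 key3

/-- Two vertices at distance 3 have no neighbours avoiding a shortest path between them. -/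
lemma no_escape_three {a b w z x y : V} (hab : G.dist a b = 3) (haw : G.Adj a w)
    (hwz : G.Adj w z) (hbz : G.Adj b z) (hax : G.Adj a x) (hby : G.Adj b y)
    (hwx : w ≠ x) (hwx' : ¬G.Adj w x) (hzx : z ≠ x) (hzx' : ¬G.Adj z x)
    (hwy : w ≠ y) (hwy' : ¬G.Adj w y) (hzy : z ≠ y) (hzy' : ¬G.Adj z y) : False := by
  have no_common : ∀ m, G.Adj a m → G.Adj m b → False := fun m h1 h2 => by
    have := hG.connected.dist_triangle (u := a) (v := m) (w := b)
    rw [dist_of_adj h1, dist_of_adj h2] at this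
    omega
  have hab' : ¬G.Adj a b := fun h => by rw [dist_of_adj h] at hab; omega
  have h1 := hG.eq_two w (x := a) (y := z) (by rintro rfl; exact hab' hbz.symm)
    (fun h => no_common z h hbz.symm) haw hwz
  have h2 := hG.eq_two z (x := b) (y := w) (by rintro rfl; exact hab' haw)
    (fun h => no_common w haw h.symm) hbz hwz.symm
  have h3 := hG.eq_two a hwx hwx' haw.symm hax
  have h4 := hG.eq_two b hzy hzy' hbz.symm hby
  have h5 := hG.two_or_three hzx hzx'
  have h6 := hG.two_or_three hwy hwy'
  have h7 := hG.two_or_three (x := a) (y := y) (by rintro rfl; exact hab' hby.symm)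
    (fun h => no_common y h hby.symm)
  have h8 := hG.two_or_three (x := b) (y := x) (by rintro rfl; exact hab' hax)
    (fun h => no_common x hax h.symm)
  have key1 := hG.lorentzian a [(b, 2), (w, -1), (z, -2), (x, -2)]
  have key2 := hG.lorentzian a [(w, 2), (z, -1), (x, 1)]
  simp only [distForm, distSum, hab, h1, h2, h3, dist_of_adj haw, dist_of_adj hbz, dist_of_adj hwz,
    dist_of_adj hax] at key1 key2
  rcases h5 with h5 | h5 <;> rcases h8 with h8 | h8 <;>
    simp [wt, h5, h8] at key1 key2

/-- A vertex adjacent to neither end of an edge `ab` has no neighbour adjacent to `a` only, if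
there is also a vertex adjacent to `b` only. -/
lemma no_long_tail {a b x z y : V} (hab : G.Adj a b) (hax : G.Adj a x) (hby : G.Adj b y)
    (hxz : G.Adj x z) (hxb : x ≠ b) (hbx : ¬G.Adj b x) (hya : y ≠ a) (hay : ¬G.Adj a y)
    (hza : z ≠ a) (haz : ¬G.Adj a z) (hbz : ¬G.Adj b z) : False := by
  have h1 := hG.eq_two a hxb.symm hbx hab.symm hax
  have h2 := hG.eq_two b hya.symm hay hab hby
  have h3 := hG.eq_two x hza.symm haz hax hxz
  have h4 := hG.two_or_three (x := b) (y := z) (by rintro rfl; exact haz hab) hbz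
  have h5 := hG.one_or_two_or_three (x := x) (y := y) (by rintro rfl; exact hbx hby)
  have h6 := hG.one_or_two_or_three (x := z) (y := y) (by rintro rfl; exact hbz hby)
  have key1 := hG.lorentzian a [(b, 2), (x, 1), (y, -1)]
  have key2 := hG.lorentzian x [(a, 1), (b, 2), (z, 2), (y, -2)]
  have key3 := hG.lorentzian a [(b, 1), (x, 2), (z, -1)]
  simp only [distForm, distSum, G.dist_comm (u := x) (v := a), G.dist_comm (u := x) (v := b),
    h1, h2, h3, dist_of_adj hab, dist_of_adj hax, dist_of_adj hby, dist_of_adj hxz] at key1 key2 key3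
  rcases h4 with h4 | h4 <;> rcases h5 with h5 | h5 | h5 <;> rcases h6 with h6 | h6 | h6 <;>
    simp [wt, h4, h5, h6] at key1 key2 key3

end LorentzianDiamThree

/-- `P` is the vertex set of a component of `G - {a, b}` in which both `a` and `b` have a
neighbour. -/
structure IsFullSide {V : Type*} (G : SimpleGraph V) (a b : V) (P : Set V) : Prop where
  ne_left {x : V} (hx : x ∈ P) : x ≠ a
  ne_right {x : V} (hx : x ∈ P) : x ≠ b
  closed {x y : V} (hx : x ∈ P) (hxy : G.Adj x y) : y = a ∨ y = b ∨ y ∈ P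
  induct (T : Set V) {x : V} (hx : x ∈ P) (hxT : x ∈ T)
    (hT : ∀ y ∈ P, y ∈ T → ∀ z ∈ P, G.Adj y z → z ∈ T) : P ⊆ T
  exists_adj_left : ∃ x ∈ P, G.Adj a x
  exists_adj_right : ∃ x ∈ P, G.Adj b x

/-- `x` and `y` are adjacent in `G - {a, b}`. -/
def AdjAvoiding {V : Type*} (G : SimpleGraph V) (a b x y : V) : Prop :=
  G.Adj x y ∧ (x ≠ a ∧ x ≠ b) ∧ (y ≠ a ∧ y ≠ b)

/-- The vertices reachable from `u` in `G - {a, b}`. -/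
def avoidingComponent {V : Type*} (G : SimpleGraph V) (a b u : V) : Set V :=
  {x | Relation.ReflTransGen (AdjAvoiding G a b) u x}

section Separation

variable {V : Type*} {G : SimpleGraph V} {a b u v : V}

lemma exists_walk_of_mem_avoidingComponent (hu : u ≠ a ∧ u ≠ b)
    (h : v ∈ avoidingComponent G a b u) : ∃ w : G.Walk v u, ∀ x ∈ w.support, x ≠ a ∧ x ≠ b := by
  induction h with
  | refl => exact ⟨.nil, by simpa using hu⟩
  | tail _ hyz ih =>
    obtain ⟨w, hw⟩ := ih
    refine ⟨.cons hyz.1.symm w, ?_⟩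
    simp only [SimpleGraph.Walk.support_cons, List.mem_cons, forall_eq_or_imp]
    exact ⟨hyz.2.2, hw⟩

lemma mem_avoidingComponent_symm (h : v ∈ avoidingComponent G a b u) :
    u ∈ avoidingComponent G a b v :=
  Relation.ReflTransGen.mono (r := Function.swap (AdjAvoiding G a b))
    (fun _ _ h => ⟨h.1.symm, h.2.2, h.2.1⟩) _ _ h.swap

lemma ne_of_mem_avoidingComponent (hu : u ≠ a ∧ u ≠ b)
    (h : v ∈ avoidingComponent G a b u) : v ≠ a ∧ v ≠ b := by
  obtain ⟨w, hw⟩ := exists_walk_of_mem_avoidingComponent hu h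
  exact hw v w.start_mem_support

lemma avoidingComponent_closed (hu : u ≠ a ∧ u ≠ b) {x y : V}
    (hx : x ∈ avoidingComponent G a b u) (hxy : G.Adj x y) :
    y = a ∨ y = b ∨ y ∈ avoidingComponent G a b u := by
  by_cases hya : y = a
  · exact Or.inl hya
  by_cases hyb : y = b
  · exact Or.inr (Or.inl hyb)
  · exact Or.inr (Or.inr (hx.tail ⟨hxy, ne_of_mem_avoidingComponent hu hx, hya, hyb⟩))

lemma exists_adj_of_walk {P : Set V} (hP : ∀ x ∈ P, ∀ y, G.Adj x y → y = a ∨ y = b ∨ y ∈ P)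
    (w : G.Walk u v) (hw : ∀ x ∈ w.support, x ≠ b) (hu : u ∈ P) (hv : v ∉ P) :
    ∃ x ∈ P, G.Adj a x := by
  induction w with
  | nil => exact absurd hu hv
  | @cons x y z hxy w ih =>
    simp only [SimpleGraph.Walk.support_cons, List.mem_cons, forall_eq_or_imp] at hw
    rcases hP x hu y hxy with rfl | rfl | hy
    · exact ⟨x, hu, hxy.symm⟩
    · exact absurd rfl (hw.2 y w.start_mem_support)
    · exact ih hw.2 hy hv

lemma avoidingComponent_isFullSide (hu : u ≠ a ∧ u ≠ b)
    (hv : v ∉ avoidingComponent G a b u) (wa wb : G.Walk u v)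
    (hwa : ∀ x ∈ wa.support, x ≠ a) (hwb : ∀ x ∈ wb.support, x ≠ b) :
    IsFullSide G a b (avoidingComponent G a b u) where
  ne_left hx := (ne_of_mem_avoidingComponent hu hx).1
  ne_right hx := (ne_of_mem_avoidingComponent hu hx).2
  closed := avoidingComponent_closed hu
  induct T x hx hxT hT := by
    have key : ∀ y, Relation.ReflTransGen (AdjAvoiding G a b) x y → y ∈ T := by
      intro y hxy
      induction hxy with
      | refl => exact hxT
      | tail hxy hyz ih => exact hT _ (hx.trans hxy) ih _ ((hx.trans hxy).tail hyz) hyz.1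
    intro y hy
    exact key y (Relation.ReflTransGen.trans (mem_avoidingComponent_symm hx) hy)
  exists_adj_left := exists_adj_of_walk (fun _ hx _ => avoidingComponent_closed hu hx) wb hwb
    Relation.ReflTransGen.refl hv
  exists_adj_right := exists_adj_of_walk (b := a)
    (fun _ hx _ h => or_left_comm.1 (avoidingComponent_closed hu hx h)) wa hwa
    Relation.ReflTransGen.refl hv

lemma exists_isFullSide [DecidableEq V] (hS : IsUVSeparator G {a, b} u v) (hab : a ≠ b)
    (hmin : ∀ T : Finset V, T ⊂ {a, b} → ¬IsUVSeparator G T u v) :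
    ∃ P Q : Set V, IsFullSide G a b P ∧ IsFullSide G a b Q ∧ Disjoint P Q := by
  obtain ⟨hu, hv, hw⟩ := hS
  simp only [Finset.mem_insert, Finset.mem_singleton, not_or] at hu hv hw
  have hvu : v ∉ avoidingComponent G a b u := fun h => by
    obtain ⟨w, hw'⟩ := exists_walk_of_mem_avoidingComponent hu h
    obtain ⟨x, hx, hx'⟩ := hw w.reverse
    have := hw' x (by simpa using hx)
    tauto
  have huv : u ∉ avoidingComponent G a b v := fun h => hvu (mem_avoidingComponent_symm h)
  have hwalk : ∀ c ∈ ({a, b} : Finset V), ∃ w : G.Walk u v, ∀ x ∈ w.support, x ≠ c := by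
    intro c hc
    have h := hmin {c} (Finset.ssubset_iff_subset_ne.2 ⟨by simpa using hc, fun h => by
      have := congrArg Finset.card h
      simp [hab] at this⟩)
    simp only [Finset.mem_insert, Finset.mem_singleton] at hc
    simp only [IsUVSeparator, Finset.mem_singleton, not_and, not_forall, not_exists] at h
    exact h (by rintro rfl; tauto) (by rintro rfl; tauto)
  obtain ⟨wa, hwa⟩ := hwalk a (by simp)
  obtain ⟨wb, hwb⟩ := hwalk b (by simp)
  refine ⟨_, _, avoidingComponent_isFullSide hu hvu wa wb hwa hwb,
    avoidingComponent_isFullSide hv huv wa.reverse wb.reverse (by simpa using hwa)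
      (by simpa using hwb), ?_⟩
  rw [Set.disjoint_left]
  intro x hx hx'
  exact hvu (hx.trans (mem_avoidingComponent_symm hx'))

end Separation

namespace IsFullSide

variable {V : Type*} {G : SimpleGraph V} {a b : V} {P : Set V}

lemma not_adj (hP : IsFullSide G a b P) {w x : V} (hw : w ∉ P) (hwa : w ≠ a) (hwb : w ≠ b)
    (hx : x ∈ P) : w ≠ x ∧ ¬G.Adj w x := by
  refine ⟨fun h => hw (h ▸ hx), fun h => ?_⟩
  rcases hP.closed hx h.symm with h | h | h
  exacts [hwa h, hwb h, hw h]

lemma dist_ne_two (hP : IsFullSide G a b P) (hG : LorentzianDiamThree G) (hab : a ≠ b)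
    (hab' : ¬G.Adj a b) {w : V} (hw : w ∉ P) (haw : G.Adj a w) (hwb : G.Adj w b) : False := by
  obtain ⟨x, hx, hax⟩ := hP.exists_adj_left
  obtain ⟨y, hy, hby⟩ := hP.exists_adj_right
  obtain ⟨h1, h2⟩ := hP.not_adj hw haw.ne' hwb.ne hx
  obtain ⟨h3, h4⟩ := hP.not_adj hw haw.ne' hwb.ne hy
  exact hG.no_escape_two hab hab' haw hwb.symm hax hby h1 h2 h3 h4

lemma dist_ne_three (hP : IsFullSide G a b P) (hG : LorentzianDiamThree G)
    (hab : G.dist a b = 3) {w z : V} (hw : w ∉ P) (haw : G.Adj a w) (hwz : G.Adj w z)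
    (hzb : G.Adj z b) : False := by
  have hwb : w ≠ b := by rintro rfl; simp [dist_of_adj haw] at hab
  have hza : z ≠ a := by rintro rfl; simp [dist_of_adj hzb] at hab
  have hz : z ∉ P := fun hz => (hP.not_adj hw haw.ne' hwb hz).2 hwz
  obtain ⟨x, hx, hax⟩ := hP.exists_adj_left
  obtain ⟨y, hy, hby⟩ := hP.exists_adj_right
  obtain ⟨h1, h2⟩ := hP.not_adj hw haw.ne' hwb hx
  obtain ⟨h3, h4⟩ := hP.not_adj hw haw.ne' hwb hy
  obtain ⟨h5, h6⟩ := hP.not_adj hz hza hzb.ne hx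
  obtain ⟨h7, h8⟩ := hP.not_adj hz hza hzb.ne hy
  exact hG.no_escape_three hab haw hwz hzb.symm hax hby h1 h2 h5 h6 h3 h4 h7 h8

lemma adj_of_disjoint {Q : Set V} (hP : IsFullSide G a b P) (hQ : IsFullSide G a b Q)
    (hPQ : Disjoint P Q) (hG : LorentzianDiamThree G) (hab : a ≠ b) : G.Adj a b := by
  by_contra hab'
  obtain ⟨p, hp⟩ := hG.connected.exists_walk_length_eq_dist a b
  have notin : ∀ w, w ∉ P ∨ w ∉ Q := fun w =>
    or_iff_not_imp_left.2 fun h => Set.disjoint_left.1 hPQ (not_not.1 h)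
  rcases p with _ | ⟨h1, _ | ⟨h2, _ | ⟨h3, _ | ⟨h4, p⟩⟩⟩⟩
  · exact hab rfl
  · exact hab' h1
  · rcases notin _ with h | h
    exacts [hP.dist_ne_two hG hab hab' h h1 h2, hQ.dist_ne_two hG hab hab' h h1 h2]
  · rcases notin _ with h | h
    exacts [hP.dist_ne_three hG hp.symm h h1 h2 h3, hQ.dist_ne_three hG hp.symm h h1 h2 h3]
  · have := hG.dist_le a b
    simp only [SimpleGraph.Walk.length_cons] at hp
    omega

lemma exists_common_neighbor (hP : IsFullSide G a b P) (hG : LorentzianDiamThree G)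
    (hab : G.Adj a b) : ∃ c ∈ P, G.Adj a c ∧ G.Adj b c := by
  by_contra! h
  obtain ⟨x, hx, hax⟩ := hP.exists_adj_left
  obtain ⟨y, hy, hby⟩ := hP.exists_adj_right
  have hay : ¬G.Adj a y := fun hay => h y hy hay hby
  refine hay (hP.induct {x | G.Adj a x} hx hax (fun z hz haz t ht hzt => ?_) hy)
  by_contra hat
  by_cases hbt : G.Adj b t
  · exact hG.no_cycle4 (hP.ne_left ht).symm hat (hP.ne_right hz).symm (h z hz haz) hab hbt.symm
      haz hzt.symm
  · exact hG.no_long_tail hab haz hby hzt (hP.ne_right hz) (h z hz haz) (hP.ne_left hy) hay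
      (hP.ne_left ht) hat hbt

end IsFullSide

/-- `x` is a neighbour of `a` outside the closed neighbourhood of `b`. -/
structure IsPrivate {V : Type*} (G : SimpleGraph V) (a b x : V) : Prop where
  adj : G.Adj a x
  ne : x ≠ b
  not_adj : ¬G.Adj b x

namespace LorentzianDiamThree

variable {V : Type*} {G : SimpleGraph V} {a b : V} (hG : LorentzianDiamThree G) (hab : G.Adj a b)

include hG

lemma dist_private {x y : V} (hx : IsPrivate G a b x) (hy : IsPrivate G a b y) (hxy : x ≠ y)
    (h : ¬G.Adj x y) : G.dist x y = 2 :=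
  hG.eq_two a hxy h hx.adj.symm hy.adj

include hab

lemma dist_right {x : V} (hx : IsPrivate G a b x) : G.dist b x = 2 :=
  hG.eq_two a hx.ne.symm hx.not_adj hab.symm hx.adj

lemma dist_private_private {x y : V} (hx : IsPrivate G a b x) (hy : IsPrivate G b a y) :
    G.dist x y = 3 := by
  have hne : x ≠ y := by rintro rfl; exact hx.not_adj hy.adj
  have h1 := hG.dist_right hab hx
  have h2 := hG.dist_right hab.symm hy
  rcases hG.one_or_two_or_three hne with h | h | h
  · have hxy := SimpleGraph.dist_eq_one_iff_adj.1 h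
    exact (hG.no_cycle4 hy.ne.symm hy.not_adj hx.ne (fun h => hx.not_adj h.symm) hx.adj hxy.symm hab
      hy.adj.symm).elim
  · have key := hG.lorentzian a [(b, 2), (x, 1), (y, -1)]
    simp [distForm, distSum, wt, h, h1, h2, dist_of_adj hab, dist_of_adj hx.adj,
      dist_of_adj hy.adj] at key
  · exact h

lemma private_subsingleton {x y z w : V} (hx : IsPrivate G a b x) (hy : IsPrivate G a b y)
    (hxy : x ≠ y) (hxy' : ¬G.Adj x y) (hz : IsPrivate G b a z) (hw : IsPrivate G b a w) :
    z = w := by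
  by_contra hne
  have h := hG.dist_private hx hy hxy hxy'
  have key1 := hG.lorentzian a [(b, -3), (x, -1), (y, -1), (z, 1), (w, 1)]
  have key2 := hG.lorentzian a [(b, -8), (x, -3), (y, -3), (z, 2), (w, 2)]
  simp only [distForm, distSum, h, dist_of_adj hab, dist_of_adj hx.adj, dist_of_adj hy.adj,
    dist_of_adj hz.adj, dist_of_adj hw.adj, hG.dist_right hab hx, hG.dist_right hab hy,
    hG.dist_right hab.symm hz, hG.dist_right hab.symm hw, hG.dist_private_private hab hx hz,
    hG.dist_private_private hab hx hw, hG.dist_private_private hab hy hz,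
    hG.dist_private_private hab hy hw] at key1 key2
  by_cases hzw : G.Adj z w
  · simp [wt, dist_of_adj hzw] at key2
  · simp [wt, hG.dist_private hz hw hne hzw] at key1

lemma private_adj_iff {x y z w : V} (hx : IsPrivate G a b x) (hy : IsPrivate G a b y)
    (hxy : x ≠ y) (hxy' : ¬G.Adj x y) (hz : IsPrivate G a b z) (hxz : x ≠ z) (hyz : y ≠ z)
    (hw : IsPrivate G b a w) : G.Adj x z ↔ ¬G.Adj y z := by
  have key1 := hG.lorentzian a [(b, -2), (x, -2), (y, -2), (z, 2), (w, 1)]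
  have key2 := hG.lorentzian a [(b, -4), (x, -1), (y, -1), (z, -1), (w, 2)]
  simp only [distForm, distSum, hG.dist_private hx hy hxy hxy', dist_of_adj hab,
    dist_of_adj hx.adj, dist_of_adj hy.adj, dist_of_adj hz.adj, dist_of_adj hw.adj,
    hG.dist_right hab hx, hG.dist_right hab hy, hG.dist_right hab hz, hG.dist_right hab.symm hw,
    hG.dist_private_private hab hx hw, hG.dist_private_private hab hy hw,
    hG.dist_private_private hab hz hw] at key1 key2
  by_cases hxz' : G.Adj x z <;> by_cases hyz' : G.Adj y z <;>
    simp only [hxz', hyz', not_true, not_false_eq_true, iff_true, iff_false]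
  · simp [wt, dist_of_adj hxz', dist_of_adj hyz'] at key1
  · simp [wt, hG.dist_private hx hz hxz hxz', hG.dist_private hy hz hyz hyz'] at key2

/-- No three pairwise adjacent private neighbours of `a` are all non-adjacent to a fourth one. -/
lemma no_private_triangle {x y z t w : V} (hx : IsPrivate G a b x) (hy : IsPrivate G a b y)
    (hxy : x ≠ y) (hxy' : ¬G.Adj x y) (hz : IsPrivate G a b z) (hxz : x ≠ z) (hxz' : ¬G.Adj x z)
    (ht : IsPrivate G a b t) (hxt : x ≠ t) (hxt' : ¬G.Adj x t) (hyz : G.Adj y z)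
    (hyt : G.Adj y t) (hzt : G.Adj z t) (hw : IsPrivate G b a w) : False := by
  have key := hG.lorentzian a [(b, 14), (x, 5), (y, 2), (z, 2), (t, 2), (w, -7)]
  simp [distForm, distSum, wt, hG.dist_private hx hy hxy hxy', hG.dist_private hx hz hxz hxz',
    hG.dist_private hx ht hxt hxt', dist_of_adj hyz, dist_of_adj hyt, dist_of_adj hzt,
    dist_of_adj hab, dist_of_adj hx.adj, dist_of_adj hy.adj, dist_of_adj hz.adj,
    dist_of_adj ht.adj, dist_of_adj hw.adj, hG.dist_right hab hx, hG.dist_right hab hy,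
    hG.dist_right hab hz, hG.dist_right hab ht, hG.dist_right hab.symm hw,
    hG.dist_private_private hab hx hw, hG.dist_private_private hab hy hw,
    hG.dist_private_private hab hz hw, hG.dist_private_private hab ht hw] at key

/-- Four private neighbours of `a` do not induce two disjoint edges. -/
lemma no_private_matching {x y z t w : V} (hx : IsPrivate G a b x) (hy : IsPrivate G a b y)
    (hxy : x ≠ y) (hxy' : ¬G.Adj x y) (hz : IsPrivate G a b z) (hyz : y ≠ z) (hyz' : ¬G.Adj y z)
    (ht : IsPrivate G a b t) (hxt : x ≠ t) (hxt' : ¬G.Adj x t) (hzt : z ≠ t) (hzt' : ¬G.Adj z t)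
    (hxz : G.Adj x z) (hyt : G.Adj y t) (hw : IsPrivate G b a w) : False := by
  have key := hG.lorentzian a [(b, -6), (x, -1), (y, -1), (z, -1), (t, -1), (w, 3)]
  simp [distForm, distSum, wt, hG.dist_private hx hy hxy hxy', hG.dist_private hy hz hyz hyz',
    hG.dist_private hx ht hxt hxt', hG.dist_private hz ht hzt hzt', dist_of_adj hxz,
    dist_of_adj hyt,
    dist_of_adj hab, dist_of_adj hx.adj, dist_of_adj hy.adj, dist_of_adj hz.adj,
    dist_of_adj ht.adj, dist_of_adj hw.adj, hG.dist_right hab hx, hG.dist_right hab hy,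
    hG.dist_right hab hz, hG.dist_right hab ht, hG.dist_right hab.symm hw,
    hG.dist_private_private hab hx hw, hG.dist_private_private hab hy hw,
    hG.dist_private_private hab hz hw, hG.dist_private_private hab ht hw] at key

lemma private_eq_of_not_adj {x y z t w : V} (hx : IsPrivate G a b x) (hy : IsPrivate G a b y)
    (hxy : x ≠ y) (hxy' : ¬G.Adj x y) (hz : IsPrivate G a b z) (hxz : x ≠ z) (hyz : y ≠ z)
    (ht : IsPrivate G a b t) (hxt : x ≠ t) (hyt : y ≠ t) (hw : IsPrivate G b a w) : z = t := by
  by_contra hzt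
  have h1 := hG.private_adj_iff hab hx hy hxy hxy' hz hxz hyz hw
  have h2 := hG.private_adj_iff hab hx hy hxy hxy' ht hxt hyt hw
  have h3 : ¬G.Adj z t → (G.Adj z x ↔ ¬G.Adj t x) := fun h =>
    hG.private_adj_iff hab hz ht hzt h hx hxz.symm hxt.symm hw
  have h4 : ¬G.Adj y z → (G.Adj y t ↔ ¬G.Adj z t) := fun h =>
    hG.private_adj_iff hab hy hz hyz h ht hyt hzt hw
  have h5 : ¬G.Adj x z → (G.Adj x t ↔ ¬G.Adj z t) := fun h =>
    hG.private_adj_iff hab hx hz hxz h ht hxt hzt hw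
  rw [G.adj_comm z x, G.adj_comm t x] at h3
  by_cases hxz' : G.Adj x z <;> by_cases hxt' : G.Adj x t <;>
    simp only [hxz', hxt', true_iff, false_iff, not_not, not_true, not_false_eq_true, imp_false,
      true_imp_iff] at h1 h2 h3 h4 h5
  · exact hG.no_private_triangle hab hy hx hxy.symm (fun h => hxy' h.symm) hz hyz h1 ht hyt h2
      hxz' hxt' h3 hw
  · exact hG.no_private_matching hab hx hy hxy hxy' hz hyz h1 ht hxt hxt' hzt
      ((h4 h1).1 h2) hxz' h2 hw
  · exact hG.no_private_matching hab hy hx hxy.symm (fun h => hxy' h.symm) hz hxz hxz' ht hyt h2 hzt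
      h5 h1 hxt' hw
  · exact hG.no_private_triangle hab hx hy hxy hxy' hz hxz hxz' ht hxt hxt' h1 h2 h3 hw

end LorentzianDiamThree

/-- `a, b, c, d` induce `K₄` minus the edge `cd` in a graph satisfying our hypotheses. -/
structure LorentzianDiamond {V : Type*} (G : SimpleGraph V) (a b c d : V) : Prop
    extends LorentzianDiamThree G where
  ab : G.Adj a b
  ac : G.Adj a c
  ad : G.Adj a d
  bc : G.Adj b c
  bd : G.Adj b d
  ne : c ≠ d
  not_adj : ¬G.Adj c d

namespace LorentzianDiamond

variable {V : Type*} {G : SimpleGraph V} {a b c d : V}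

lemma swap (h : LorentzianDiamond G a b c d) : LorentzianDiamond G b a c d :=
  { h with ab := h.ab.symm, ac := h.bc, ad := h.bd, bc := h.ac, bd := h.ad }

lemma symm (h : LorentzianDiamond G a b c d) : LorentzianDiamond G a b d c :=
  { h with
    ac := h.ad, ad := h.ac, bc := h.bd, bd := h.bc, ne := h.ne.symm
    not_adj := fun h' => h.not_adj h'.symm }

variable (h : LorentzianDiamond G a b c d)

include h

lemma replace {x y : V} (hax : G.Adj a x) (hbx : G.Adj b x) (hay : G.Adj a y) (hby : G.Adj b y)
    (hne : x ≠ y) (hxy : ¬G.Adj x y) : LorentzianDiamond G a b x y :=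
  { h with ac := hax, ad := hay, bc := hbx, bd := hby, ne := hne, not_adj := hxy }

lemma dist_cd : G.dist c d = 2 :=
  h.eq_two a h.ne h.not_adj h.ac.symm h.ad

lemma not_adj_private {x : V} (hx : IsPrivate G a b x) : ¬G.Adj c x := by
  intro hcx
  by_cases hdx : G.Adj d x
  · exact h.no_cycle4 hx.ne.symm hx.not_adj h.ne h.not_adj h.bc hcx.symm h.bd hdx.symm
  have h1 := h.eq_two a (x := d) (y := x) (by rintro rfl; exact hx.not_adj h.bd) hdx h.ad.symm
    hx.adj
  have key := h.lorentzian b [(c, 2), (d, 1), (x, -1)]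
  simp [distForm, distSum, wt, h.dist_cd, h1, dist_of_adj hcx, dist_of_adj h.bc, dist_of_adj h.bd,
    h.dist_right h.ab hx] at key

lemma adj_iff {e : V} (hae : G.Adj a e) (hbe : G.Adj b e) (hce : c ≠ e) (hde : d ≠ e) :
    G.Adj c e ↔ ¬G.Adj d e := by
  have key1 := h.lorentzian a [(b, 1), (c, -2), (d, -2), (e, 2)]
  have key2 := h.lorentzian a [(b, 2), (c, -1), (d, -1), (e, -1)]
  simp only [distForm, distSum, h.dist_cd, dist_of_adj h.ab, dist_of_adj h.ac, dist_of_adj h.ad,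
    dist_of_adj h.bc, dist_of_adj h.bd, dist_of_adj hae, dist_of_adj hbe] at key1 key2
  by_cases hce' : G.Adj c e <;> by_cases hde' : G.Adj d e <;>
    simp only [hce', hde', not_true, not_false_eq_true, iff_true, iff_false]
  · simp [wt, dist_of_adj hce', dist_of_adj hde'] at key1
  · simp [wt, h.eq_two a hce hce' h.ac.symm hae, h.eq_two a hde hde' h.ad.symm hae] at key2

lemma adj_of_adj_common {z : V} (hza : z ≠ a) (hzb : z ≠ b) (hcz : G.Adj c z) :
    G.Adj a z ∨ G.Adj b z := by
  by_contra! hz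
  have h1 := h.eq_two c hza.symm hz.1 h.ac hcz
  have h2 := h.eq_two c hzb.symm hz.2 h.bc hcz
  have h3 := h.one_or_two_or_three (x := d) (y := z) (by rintro rfl; exact hz.1 h.ad)
  have key := h.lorentzian c [(a, 2), (b, 2), (d, -2), (z, 1)]
  simp only [distForm, distSum, h.dist_cd, h1, h2, dist_of_adj h.ab, dist_of_adj h.ac.symm,
    dist_of_adj h.ad, dist_of_adj h.bc.symm, dist_of_adj h.bd, dist_of_adj hcz] at key
  rcases h3 with h3 | h3 | h3 <;> simp [wt, h3] at key

lemma adj_of_adj_private {m z : V} (hza : z ≠ a) (hzb : z ≠ b) (hm : IsPrivate G a b m)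
    (hmz : G.Adj m z) : G.Adj a z ∨ G.Adj b z := by
  by_contra! hz
  have hcz : ¬G.Adj c z := fun h' => (h.adj_of_adj_common hza hzb h').elim hz.1 hz.2
  have hdz : ¬G.Adj d z := fun h' => (h.symm.adj_of_adj_common hza hzb h').elim hz.1 hz.2
  have h1 := h.eq_two m hza.symm hz.1 hm.adj hmz
  have h2 := h.two_or_three hzb.symm hz.2
  have h3 := h.two_or_three (by rintro rfl; exact hz.1 h.ac) hcz
  have h4 := h.two_or_three (by rintro rfl; exact hz.1 h.ad) hdz
  have h5 := h.eq_two a (by rintro rfl; exact hm.not_adj h.bc) (h.not_adj_private hm) h.ac.symm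
    hm.adj
  have h6 := h.eq_two a (by rintro rfl; exact hm.not_adj h.bd) (h.symm.not_adj_private hm)
    h.ad.symm hm.adj
  have key1 := h.lorentzian a [(b, 2), (c, -2), (d, -2), (m, -2), (z, 1)]
  have key2 := h.lorentzian a [(b, 1), (m, 2), (z, -1)]
  simp only [distForm, distSum, h.dist_cd, h1, h5, h6, h.dist_right h.ab hm, dist_of_adj h.ab,
    dist_of_adj h.ac, dist_of_adj h.ad, dist_of_adj h.bc, dist_of_adj h.bd, dist_of_adj hm.adj,
    dist_of_adj hmz] at key1 key2
  rcases h2 with h2 | h2 <;> rcases h3 with h3 | h3 <;> rcases h4 with h4 | h4 <;>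
    simp [wt, h2, h3, h4] at key1 key2

lemma adj_of_adj {m z : V} (hza : z ≠ a) (hzb : z ≠ b) (hma : m ≠ a) (hmb : m ≠ b)
    (hm : G.Adj a m ∨ G.Adj b m) (hmz : G.Adj m z) : G.Adj a z ∨ G.Adj b z := by
  by_cases ham : G.Adj a m <;> by_cases hbm : G.Adj b m
  · by_cases hmc : m = c
    · exact h.adj_of_adj_common hza hzb (hmc ▸ hmz)
    by_cases hmd : m = d
    · exact h.symm.adj_of_adj_common hza hzb (hmd ▸ hmz)
    by_cases hcm : G.Adj c m
    · have hdm := (h.adj_iff ham hbm (Ne.symm hmc) (Ne.symm hmd)).1 hcm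
      exact (h.replace h.ad h.bd ham hbm (Ne.symm hmd) hdm).symm.adj_of_adj_common hza hzb hmz
    · exact (h.replace h.ac h.bc ham hbm (Ne.symm hmc) hcm).symm.adj_of_adj_common hza hzb hmz
  · exact h.adj_of_adj_private hza hzb ⟨ham, hmb, hbm⟩ hmz
  · exact (h.swap.adj_of_adj_private hzb hza ⟨hbm, hma, ham⟩ hmz).symm
  · tauto

lemma adj_left_or_right {z : V} (hza : z ≠ a) (hzb : z ≠ b) : G.Adj a z ∨ G.Adj b z := by
  obtain ⟨w⟩ := h.connected.preconnected z a
  suffices key : ∀ x y, G.Walk x y → y = a → x = a ∨ x = b ∨ G.Adj a x ∨ G.Adj b x from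
    ((key z a w rfl).resolve_left hza).resolve_left hzb
  clear w
  intro x y w hy
  induction w with
  | nil => exact Or.inl hy
  | @cons x y _ hxy _ ih =>
    by_cases hxa : x = a
    · exact Or.inl hxa
    by_cases hxb : x = b
    · exact Or.inr (Or.inl hxb)
    refine Or.inr (Or.inr ?_)
    by_cases hya : y = a
    · exact Or.inl (hya ▸ hxy.symm)
    by_cases hyb : y = b
    · exact Or.inr (hyb ▸ hxy.symm)
    rcases ih hy with h' | h' | h'
    exacts [(hya h').elim, (hyb h').elim, h.adj_of_adj hxa hxb hya hyb h' hxy.symm]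

lemma no_two_adj_right {e f : V} (hae : G.Adj a e) (hbe : G.Adj b e) (haf : G.Adj a f)
    (hbf : G.Adj b f) (hce : c ≠ e) (hce' : ¬G.Adj c e) (hcf : c ≠ f) (hcf' : ¬G.Adj c f)
    (hde : G.Adj d e) (hdf : G.Adj d f) (hef : e ≠ f) : False := by
  by_cases hef' : G.Adj e f
  · have key := h.lorentzian a [(b, -7), (c, 4), (d, 2), (e, 2), (f, 2)]
    simp [distForm, distSum, wt, h.dist_cd, h.eq_two a hce hce' h.ac.symm hae,
      h.eq_two a hcf hcf' h.ac.symm haf, dist_of_adj h.ab, dist_of_adj h.ac, dist_of_adj h.ad,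
      dist_of_adj h.bc, dist_of_adj h.bd, dist_of_adj hae, dist_of_adj hbe, dist_of_adj haf,
      dist_of_adj hbf, dist_of_adj hde, dist_of_adj hdf, dist_of_adj hef'] at key
  · exact hcf' (((h.replace h.ac h.bc hae hbe hce hce').adj_iff haf hbf hcf hef).2 hef')

lemma no_adj_left_adj_right {e f : V} (hae : G.Adj a e) (hbe : G.Adj b e) (haf : G.Adj a f)
    (hbf : G.Adj b f) (hce : G.Adj c e) (hde : d ≠ e) (hde' : ¬G.Adj d e) (hcf : c ≠ f)
    (hcf' : ¬G.Adj c f) (hdf : G.Adj d f) (hef : e ≠ f) : False := by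
  by_cases hef' : G.Adj e f
  · exact ((h.replace h.ad h.bd hae hbe hde hde').adj_iff haf hbf hdf.ne hef).1 hdf hef'
  · have key := h.lorentzian a [(b, -3), (c, 1), (d, 1), (e, 1), (f, 1)]
    simp [distForm, distSum, wt, h.dist_cd, h.eq_two a hde hde' h.ad.symm hae,
      h.eq_two a hcf hcf' h.ac.symm haf, h.eq_two a hef hef' hae.symm haf, dist_of_adj h.ab,
      dist_of_adj h.ac, dist_of_adj h.ad,
      dist_of_adj h.bc, dist_of_adj h.bd, dist_of_adj hae, dist_of_adj hbe, dist_of_adj haf,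
      dist_of_adj hbf, dist_of_adj hce, dist_of_adj hdf] at key

lemma common_subsingleton {e f : V} (hae : G.Adj a e) (hbe : G.Adj b e) (haf : G.Adj a f)
    (hbf : G.Adj b f) (hce : c ≠ e) (hde : d ≠ e) (hcf : c ≠ f) (hdf : d ≠ f) : e = f := by
  by_contra hef
  have h1 := h.adj_iff hae hbe hce hde
  have h2 := h.adj_iff haf hbf hcf hdf
  by_cases hce' : G.Adj c e <;> by_cases hcf' : G.Adj c f <;>
    simp only [hce', hcf', true_iff, false_iff, not_not] at h1 h2
  · exact h.symm.no_two_adj_right hae hbe haf hbf hde h1 hdf h2 hce' hcf' hef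
  · exact h.no_adj_left_adj_right hae hbe haf hbf hce' hde h1 hcf hcf' h2 hef
  · exact h.no_adj_left_adj_right haf hbf hae hbe hcf' hdf h2 hce hce' h1 (Ne.symm hef)
  · exact h.no_two_adj_right hae hbe haf hbf hce hce' hcf hcf' h1 h2 hef

end LorentzianDiamond

lemma SimpleGraph.Embedding.isoToConnectedInducedSubgraph {V W : Type*} {G : SimpleGraph V}
    {H : SimpleGraph W} (f : G ↪g H) (hG : G.Connected) : IsoToConnectedInducedSubgraph G H :=
  ⟨Set.range f, (f.isoInduceRange.connected_iff).1 hG, ⟨f.isoInduceRange⟩⟩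

/-- The position in the full house of a vertex that is a common neighbour of `a` and `b`, or one
of `a` and `b`. -/
def houseLabel {V : Type*} [DecidableEq V] (a b c d x : V) : Fin 5 :=
  if x = a then 0 else if x = b then 1 else if x = c then 2 else if x = d then 3 else 4

namespace LorentzianDiamond

variable {V : Type*} {G : SimpleGraph V} {a b c d : V}

lemma cases_of_not_private (h : LorentzianDiamond G a b c d)
    (hE : ∀ e, G.Adj a e → G.Adj b e → c ≠ e → d ≠ e → G.Adj d e) {x : V}
    (hx : ¬(IsPrivate G a b x ∨ IsPrivate G b a x)) :
    x = a ∨ x = b ∨ x = c ∨ x = d ∨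
      x ≠ c ∧ x ≠ d ∧ G.Adj a x ∧ G.Adj b x ∧ ¬G.Adj c x ∧ G.Adj d x := by
  by_cases hxa : x = a
  · exact Or.inl hxa
  by_cases hxb : x = b
  · exact Or.inr (Or.inl hxb)
  by_cases hxc : x = c
  · exact Or.inr (Or.inr (Or.inl hxc))
  by_cases hxd : x = d
  · exact Or.inr (Or.inr (Or.inr (Or.inl hxd)))
  have hab : G.Adj a x ∧ G.Adj b x := by
    rcases h.adj_left_or_right hxa hxb with hax | hbx
    · exact ⟨hax, by_contra fun hbx => hx (Or.inl ⟨hax, hxb, hbx⟩)⟩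
    · exact ⟨by_contra fun hax => hx (Or.inr ⟨hbx, hxa, hax⟩), hbx⟩
  have hdx := hE x hab.1 hab.2 (Ne.symm hxc) (Ne.symm hxd)
  have hcx := h.adj_iff hab.1 hab.2 (Ne.symm hxc) (Ne.symm hxd)
  tauto

variable [DecidableEq V]

lemma adj_private_iff (h : LorentzianDiamond G a b c d)
    (hE : ∀ e, G.Adj a e → G.Adj b e → c ≠ e → d ≠ e → G.Adj d e) {x y : V}
    (hx : ¬(IsPrivate G a b x ∨ IsPrivate G b a x)) (hy : IsPrivate G a b y) :
    G.Adj x y ↔ houseLabel a b c d x = 0 := by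
  have hdiff : houseLabel a b c d x = 0 ↔ x = a := by
    unfold houseLabel
    split_ifs <;> simp_all
  rw [hdiff]
  rcases h.cases_of_not_private hE hx with rfl | rfl | rfl | rfl | ⟨hxc, hxd, hax, hbx, hcx, hdx⟩
  · simp [hy.adj]
  · simp [hy.not_adj, h.ab.ne']
  · simp [h.not_adj_private hy, h.ac.ne']
  · simp [h.symm.not_adj_private hy, h.ad.ne']
  · simp [(h.replace h.ac h.bc hax hbx (Ne.symm hxc) hcx).symm.not_adj_private hy, hax.ne']

lemma adj_private_iff' (h : LorentzianDiamond G a b c d)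
    (hE : ∀ e, G.Adj a e → G.Adj b e → c ≠ e → d ≠ e → G.Adj d e) {x y : V}
    (hx : ¬(IsPrivate G a b x ∨ IsPrivate G b a x)) (hy : IsPrivate G b a y) :
    G.Adj x y ↔ houseLabel a b c d x = 1 := by
  rw [h.swap.adj_private_iff (fun e h1 h2 => hE e h2 h1) (fun h' => hx h'.symm) hy]
  have := h.ab.ne
  unfold houseLabel
  split_ifs <;> simp_all

lemma fullHouse_adj_iff (h : LorentzianDiamond G a b c d)
    (hE : ∀ e, G.Adj a e → G.Adj b e → c ≠ e → d ≠ e → G.Adj d e) {x y : V}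
    (hx : ¬(IsPrivate G a b x ∨ IsPrivate G b a x))
    (hy : ¬(IsPrivate G a b y ∨ IsPrivate G b a y)) :
    fullHouse.Adj (houseLabel a b c d x) (houseLabel a b c d y) ↔ G.Adj x y := by
  have hdc : ¬G.Adj d c := fun h' => h.not_adj h'.symm
  rcases h.cases_of_not_private hE hx with rfl | rfl | rfl | rfl | ⟨hxc, hxd, hax, hbx, hcx, hdx⟩ <;>
  rcases h.cases_of_not_private hE hy with rfl | rfl | rfl | rfl | ⟨hyc, hyd, hay, hby, hcy, hdy⟩ <;>
  first
  | (simp [houseLabel, fullHouse, h.ab, h.ac, h.ad, h.bc, h.bd, h.not_adj, h.ab.symm, h.ac.symm,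
      h.ad.symm, h.bc.symm, h.bd.symm, h.ab.ne', h.ac.ne', h.ad.ne', h.bc.ne', h.bd.ne', h.ne.symm,
      hdc]; done)
  | (simp [houseLabel, fullHouse, h.ab.ne', h.ac.ne', h.ad.ne', h.bc.ne', h.bd.ne', h.ne.symm,
      hay.ne', hby.ne', hyc, hyd, hay, hby, hcy, hdy]; done)
  | (simp [houseLabel, fullHouse, h.ab.ne', h.ac.ne', h.ad.ne', h.bc.ne', h.bd.ne', h.ne.symm,
      hax.ne', hbx.ne', hxc, hxd, hax.symm, hbx.symm, G.adj_comm x, hcx, hdx]; done)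
  | (simp [houseLabel, h.common_subsingleton hax hbx hay hby (Ne.symm hxc) (Ne.symm hxd)
      (Ne.symm hyc) (Ne.symm hyd)])

lemma houseLabel_injOn (h : LorentzianDiamond G a b c d)
    (hE : ∀ e, G.Adj a e → G.Adj b e → c ≠ e → d ≠ e → G.Adj d e) {x y : V}
    (hx : ¬(IsPrivate G a b x ∨ IsPrivate G b a x))
    (hy : ¬(IsPrivate G a b y ∨ IsPrivate G b a y))
    (hxy : houseLabel a b c d x = houseLabel a b c d y) : x = y := by
  rcases h.cases_of_not_private hE hx with rfl | rfl | rfl | rfl | ⟨hxc, hxd, hax, hbx, hcx, hdx⟩ <;>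
  rcases h.cases_of_not_private hE hy with rfl | rfl | rfl | rfl | ⟨hyc, hyd, hay, hby, hcy, hdy⟩ <;>
  first
  | rfl
  | exact h.common_subsingleton hax hbx hay hby (Ne.symm hxc) (Ne.symm hxd) (Ne.symm hyc)
      (Ne.symm hyd)
  | simp [houseLabel, h.ab.ne', h.ac.ne', h.ad.ne', h.bc.ne', h.bd.ne', h.ne.symm, hay.ne',
      hby.ne', hyc, hyd] at hxy
  | simp [houseLabel, h.ab.ne', h.ac.ne', h.ad.ne', h.bc.ne', h.bd.ne', h.ne.symm, hax.ne',
      hbx.ne', hxc, hxd] at hxy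
  | simp [houseLabel, h.ab.ne', h.ac.ne', h.ad.ne', h.bc.ne', h.bd.ne', h.ne.symm] at hxy

lemma nonempty_embedding (h : LorentzianDiamond G a b c d)
    (hE : ∀ e, G.Adj a e → G.Adj b e → c ≠ e → d ≠ e → G.Adj d e)
    {W : Type*} {H : SimpleGraph W} (g : Fin 5 → W) (p : V → W) (hg : Function.Injective g)
    (hg' : ∀ i j, H.Adj (g i) (g j) ↔ fullHouse.Adj i j)
    (hA : ∀ x, IsPrivate G a b x → ∀ i, H.Adj (g i) (p x) ↔ i = 0)
    (hB : ∀ x, IsPrivate G b a x → ∀ i, H.Adj (g i) (p x) ↔ i = 1)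
    (hgp : ∀ x, IsPrivate G a b x ∨ IsPrivate G b a x → ∀ i, g i ≠ p x)
    (hp : ∀ x y, IsPrivate G a b x ∨ IsPrivate G b a x → IsPrivate G a b y ∨ IsPrivate G b a y →
      (p x = p y → x = y) ∧ (H.Adj (p x) (p y) ↔ G.Adj x y)) :
    Nonempty (G ↪g H) := by
  classical
  let f : V → W := fun x =>
    if IsPrivate G a b x ∨ IsPrivate G b a x then p x else g (houseLabel a b c d x)
  have hmixed : ∀ x y, ¬(IsPrivate G a b x ∨ IsPrivate G b a x) →
      IsPrivate G a b y ∨ IsPrivate G b a y →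
      (H.Adj (g (houseLabel a b c d x)) (p y) ↔ G.Adj x y) := by
    intro x y hx hy
    rcases hy with hy | hy
    · rw [hA y hy, h.adj_private_iff hE hx hy]
    · rw [hB y hy, h.adj_private_iff' hE hx hy]
  refine ⟨⟨⟨f, fun x y hxy => ?_⟩, fun {x y} => ?_⟩⟩
  · simp only [f] at hxy
    split_ifs at hxy with hx hy hy
    · exact (hp x y hx hy).1 hxy
    · exact (hgp x hx _ hxy.symm).elim
    · exact (hgp y hy _ hxy).elim
    · exact h.houseLabel_injOn hE hx hy (hg hxy)
  · change H.Adj (f x) (f y) ↔ G.Adj x y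
    simp only [f]
    split_ifs with hx hy hy
    · exact (hp x y hx hy).2
    · rw [H.adj_comm, G.adj_comm, hmixed y x hy hx]
    · exact hmixed x y hx hy
    · rw [hg', h.fullHouse_adj_iff hE hx hy]

end LorentzianDiamond

lemma IsPrivate.not_swap {V : Type*} {G : SimpleGraph V} {a b x : V} (hx : IsPrivate G a b x) :
    ¬IsPrivate G b a x :=
  fun h => hx.not_adj h.adj

namespace LorentzianDiamond

variable {V : Type*} {G : SimpleGraph V} {a b c d : V}

lemma exists_private (h : LorentzianDiamond G a b c d) {x y : V} (hxy : G.dist x y = 3) :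
    ∃ z, IsPrivate G a b z := by
  by_contra! hA
  have hb : ∀ z, G.dist z b ≤ 1 := by
    intro z
    by_cases hzb : z = b
    · simp [hzb]
    by_cases hza : z = a
    · simp [hza, dist_of_adj h.ab]
    have hbz : G.Adj b z := by
      by_contra hbz
      exact hA z ⟨(h.adj_left_or_right hza hzb).resolve_right hbz, hzb, hbz⟩
    rw [dist_of_adj hbz.symm]
  have := h.connected.dist_triangle (u := x) (v := b) (w := y)
  have := hb x
  have := hb y
  rw [G.dist_comm] at this
  omega

variable [DecidableEq V]

lemma nonempty_embedding_pt2 [Finite V] (h : LorentzianDiamond G a b c d)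
    (hE : ∀ e, G.Adj a e → G.Adj b e → c ≠ e → d ≠ e → G.Adj d e)
    (hA : ∃ x, IsPrivate G a b x) (hB : ∃ x, IsPrivate G b a x)
    (hA' : ∀ x y, IsPrivate G a b x → IsPrivate G a b y → x ≠ y → G.Adj x y)
    (hB' : ∀ x y, IsPrivate G b a x → IsPrivate G b a y → x ≠ y → G.Adj x y) :
    ∃ p q : ℕ, 2 ≤ p ∧ 2 ≤ q ∧ Nonempty (G ↪g Pt2Graph p q) := by
  classical
  have : Nonempty {x // IsPrivate G a b x} := nonempty_subtype.2 hA
  have : Nonempty {x // IsPrivate G b a x} := nonempty_subtype.2 hB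
  let eA := Finite.equivFin {x // IsPrivate G a b x}
  let eB := Finite.equivFin {x // IsPrivate G b a x}
  refine ⟨Nat.card {x // IsPrivate G a b x} + 1, Nat.card {x // IsPrivate G b a x} + 1,
    Nat.succ_le_succ Nat.card_pos, Nat.succ_le_succ Nat.card_pos,
    h.nonempty_embedding hE Sum.inl
      (fun x => if hx : IsPrivate G a b x then .inr (.inl (eA ⟨x, hx⟩))
        else if hx : IsPrivate G b a x then .inr (.inr (eB ⟨x, hx⟩)) else .inl 0)
      Sum.inl_injective (fun i j => by simp [Pt2Graph, fullHouse]) ?_ ?_ ?_ ?_⟩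
  · intro x hx i
    simp [hx, Pt2Graph]
  · intro x hx i
    simp [hx, hx.not_swap, Pt2Graph]
  · rintro x (hx | hx) i
    · simp [hx]
    · simp [hx, hx.not_swap]
  · have key : ∀ x y, IsPrivate G a b x → IsPrivate G b a y → ¬G.Adj x y := fun x y hx hy hxy => by
      have := h.dist_private_private h.ab hx hy
      rw [dist_of_adj hxy] at this
      omega
    rintro x y (hx | hx) (hy | hy)
    · have := hA' x y hx hy
      have := G.ne_of_adj (a := x) (b := y)
      simp [hx, hy, Pt2Graph]
      tauto
    · simp [hx, hy, hy.not_swap, Pt2Graph, key x y hx hy]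
    · simp [hx, hy, hx.not_swap, Pt2Graph, G.adj_comm x, key y x hy hx]
    · have := hB' x y hx hy
      have := G.ne_of_adj (a := x) (b := y)
      simp [hx, hy, hx.not_swap, hy.not_swap, Pt2Graph]
      tauto

lemma nonempty_embedding_pt1_aux (h : LorentzianDiamond G a b c d)
    (hE : ∀ e, G.Adj a e → G.Adj b e → c ≠ e → d ≠ e → G.Adj d e) {x y z : V}
    (hx : IsPrivate G a b x) (hy : IsPrivate G b a y) (hz : IsPrivate G b a z) (hyz : y ≠ z)
    (hyz' : ¬G.Adj y z) (hy' : ∀ t, IsPrivate G b a t → ¬G.Adj y t) :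
    Nonempty (G ↪g Pt1Graph) := by
  have hA : ∀ t, IsPrivate G a b t → t = x := fun t ht =>
    h.private_subsingleton h.ab.symm hy hz hyz hyz' ht hx
  have hB : ∀ t, IsPrivate G b a t → t ≠ y → t ≠ z → G.Adj z t := fun t ht hty htz => by
    have := h.private_adj_iff h.ab.symm hy hz hyz hyz' ht hty.symm htz.symm hx
    have := hy' t ht
    tauto
  have hB' : ∀ s t, IsPrivate G b a s → IsPrivate G b a t → s ≠ y → s ≠ z → t ≠ y → t ≠ z →
      s = t := fun s t hs ht hsy hsz hty htz =>
    h.private_eq_of_not_adj h.ab.symm hy hz hyz hyz' hs hsy.symm hsz.symm ht hty.symm htz.symm hx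
  have key : ∀ t, IsPrivate G b a t → ¬G.Adj x t := fun t ht hxt => by
    have := h.dist_private_private h.ab hx ht
    rw [dist_of_adj hxt] at this
    omega
  have hxy : x ≠ y := by rintro rfl; exact hx.not_swap hy
  have hxz : x ≠ z := by rintro rfl; exact hx.not_swap hz
  refine h.nonempty_embedding hE (Fin.castLE (by omega))
    (fun t => if t = x then 5 else if t = y then 6 else if t = z then 7 else 8)
    (Fin.castLE_injective _) (fun i j => by
      fin_cases i <;> fin_cases j <;> simp [Pt1Graph, fullHouse]) ?_ ?_ ?_ ?_
  · intro t ht i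
    rw [hA t ht]
    fin_cases i <;> simp [Pt1Graph]
  · intro t ht i
    have htx : t ≠ x := by rintro rfl; exact hx.not_swap ht
    simp only [htx, if_false]
    split_ifs <;> fin_cases i <;> simp [Pt1Graph]
  · intro t _ i
    split_ifs <;> fin_cases i <;> simp
  · have cases : ∀ t, IsPrivate G a b t ∨ IsPrivate G b a t →
        t = x ∨ t = y ∨ t = z ∨ (IsPrivate G b a t ∧ t ≠ x ∧ t ≠ y ∧ t ≠ z) := by
      rintro t (ht | ht)
      · exact Or.inl (hA t ht)
      · have htx : t ≠ x := by rintro rfl; exact hx.not_swap ht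
        tauto
    have hyx' : ¬G.Adj y x := fun h' => key y hy h'.symm
    have hzx' : ¬G.Adj z x := fun h' => key z hz h'.symm
    have hzy' : ¬G.Adj z y := fun h' => hyz' h'.symm
    intro s t hs ht
    rcases cases s hs with rfl | rfl | rfl | ⟨hs, hsx, hsy, hsz⟩ <;>
    rcases cases t ht with rfl | rfl | rfl | ⟨ht, htx, hty, htz⟩ <;>
    first
    | (simp [Pt1Graph]; done)
    | simp [hB' s t hs ht hsy hsz hty htz]
    | simp [Pt1Graph, htx, hty, htz, key t ht, hy' t ht, hB t ht hty htz, Ne.symm htx, Ne.symm hty,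
        Ne.symm htz, hxy.symm, hxz.symm, hyz.symm]
    | simp [Pt1Graph, hsx, hsy, hsz, G.adj_comm s, key s hs, hy' s hs, hB s hs hsy hsz, hxy.symm,
        hxz.symm, hyz.symm]
    | simp [Pt1Graph, hxy, hxz, hyz, hxy.symm, hxz.symm, hyz.symm, key _ hy, key _ hz, hyz',
        hyx', hzx', hzy']

lemma nonempty_embedding_pt1 (h : LorentzianDiamond G a b c d)
    (hE : ∀ e, G.Adj a e → G.Adj b e → c ≠ e → d ≠ e → G.Adj d e) {x y z : V}
    (hx : IsPrivate G a b x) (hy : IsPrivate G b a y) (hz : IsPrivate G b a z) (hyz : y ≠ z)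
    (hyz' : ¬G.Adj y z) : Nonempty (G ↪g Pt1Graph) := by
  by_cases hy' : ∀ t, IsPrivate G b a t → ¬G.Adj y t
  · exact h.nonempty_embedding_pt1_aux hE hx hy hz hyz hyz' hy'
  · push Not at hy'
    obtain ⟨t, ht, hyt⟩ := hy'
    refine h.nonempty_embedding_pt1_aux hE hx hz hy hyz.symm (fun h' => hyz' h'.symm)
      fun s hs hzs => ?_
    have hzt : z ≠ t := by rintro rfl; exact hyz' hyt
    have hys : y ≠ s := by rintro rfl; exact hyz' hzs.symm
    obtain rfl := h.private_eq_of_not_adj h.ab.symm hy hz hyz hyz' hs hys hzs.ne ht hyt.ne hzt hx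
    exact (h.private_adj_iff h.ab.symm hy hz hyz hyz' hs hys hzs.ne hx).1 hyt hzs

lemma exists_embedding [Finite V] (h : LorentzianDiamond G a b c d)
    (hE : ∀ e, G.Adj a e → G.Adj b e → c ≠ e → d ≠ e → G.Adj d e)
    (hA : ∃ x, IsPrivate G a b x) (hB : ∃ x, IsPrivate G b a x) :
    Nonempty (G ↪g Pt1Graph) ∨
      ∃ p q : ℕ, 2 ≤ p ∧ 2 ≤ q ∧ Nonempty (G ↪g Pt2Graph p q) := by
  by_cases hA' : ∀ x y, IsPrivate G a b x → IsPrivate G a b y → x ≠ y → G.Adj x y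
  · by_cases hB' : ∀ x y, IsPrivate G b a x → IsPrivate G b a y → x ≠ y → G.Adj x y
    · exact Or.inr (h.nonempty_embedding_pt2 hE hA hB hA' hB')
    · push Not at hB'
      obtain ⟨x, hx⟩ := hA
      obtain ⟨y, z, hy, hz, hyz, hyz'⟩ := hB'
      exact Or.inl (h.nonempty_embedding_pt1 hE hx hy hz hyz hyz')
  · push Not at hA'
    obtain ⟨x, hx⟩ := hB
    obtain ⟨y, z, hy, hz, hyz, hyz'⟩ := hA'
    exact Or.inl (h.swap.nonempty_embedding_pt1 (fun e h1 h2 => hE e h2 h1) hx hy hz hyz hyz')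

lemma isoToConnectedInducedSubgraph [Finite V] (h : LorentzianDiamond G a b c d) {x y : V}
    (hxy : G.dist x y = 3) : IsoToConnectedInducedSubgraph G Pt1Graph ∨
      ∃ p q : ℕ, 2 ≤ p ∧ 2 ≤ q ∧ IsoToConnectedInducedSubgraph G (Pt2Graph p q) := by
  have key : Nonempty (G ↪g Pt1Graph) ∨
      ∃ p q : ℕ, 2 ≤ p ∧ 2 ≤ q ∧ Nonempty (G ↪g Pt2Graph p q) := by
    have hA := h.exists_private hxy
    have hB := h.swap.exists_private hxy
    by_cases hE : ∀ e, G.Adj a e → G.Adj b e → c ≠ e → d ≠ e → G.Adj d e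
    · exact h.exists_embedding hE hA hB
    · push Not at hE
      obtain ⟨e, hae, hbe, hce, hde, hde'⟩ := hE
      refine h.symm.exists_embedding (fun f haf hbf hdf hcf => ?_) hA hB
      rw [h.common_subsingleton haf hbf hae hbe hcf hdf hce hde]
      exact (h.adj_iff hae hbe hce hde).2 hde'
  rcases key with ⟨⟨f⟩⟩ | ⟨p, q, hp, hq, ⟨f⟩⟩
  · exact Or.inl (f.isoToConnectedInducedSubgraph h.connected)
  · exact Or.inr ⟨p, q, hp, hq, f.isoToConnectedInducedSubgraph h.connected⟩

end LorentzianDiamond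

/-- A connected graph of diameter 3 with a minimal vertex separator of cardinality 2
and `λ₂ < -1/2` is isomorphic to a connected induced subgraph of `Pt_1` or of a
triple block graph `Pt_2(p,q)` with `p, q ≥ 2`. -/
theorem stmt_6 {V : Type*} [Fintype V] [DecidableEq V] (G : SimpleGraph V)
    (hconn : G.Connected) (hdiam : graphDiam G = 3)
    (hmvs : ∃ S : Finset V, S.card = 2 ∧ IsMinimalVertexSeparator G S)
    (hlam : lambda2 G < -1/2) :
    IsoToConnectedInducedSubgraph G Pt1Graph ∨
      ∃ p q : ℕ, 2 ≤ p ∧ 2 ≤ q ∧ IsoToConnectedInducedSubgraph G (Pt2Graph p q) := by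
  have hdist : ∀ x y, G.dist x y ≤ 3 := fun x y => hdiam ▸
    Finset.le_sup (f := fun p : V × V => G.dist p.1 p.2) (Finset.mem_univ (x, y))
  obtain ⟨S, hS, u, v, huv, -, hsep, hmin⟩ := hmvs
  obtain ⟨a, b, hab, rfl⟩ := Finset.card_eq_two.1 hS
  have hG : LorentzianDiamThree G :=
    ⟨hconn, hdist, isDistLorentzian_of_lambda2_lt G hconn
      (Fintype.one_lt_card_iff.2 ⟨a, b, hab⟩) hlam⟩
  obtain ⟨P, Q, hP, hQ, hPQ⟩ := exists_isFullSide hsep hab hmin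
  have hab' := hP.adj_of_disjoint hQ hPQ hG hab
  obtain ⟨c, hc, hac, hbc⟩ := hP.exists_common_neighbor hG hab'
  obtain ⟨d, hd, had, hbd⟩ := hQ.exists_common_neighbor hG hab'
  obtain ⟨hcd, hcd'⟩ := hQ.not_adj (Set.disjoint_left.1 hPQ hc) hac.ne' hbc.ne' hd
  have hdiamond : LorentzianDiamond G a b c d := ⟨hG, hab', hac, had, hbc, hbd, hcd, hcd'⟩
  obtain ⟨p, -, hp⟩ := Finset.exists_mem_eq_sup Finset.univ ⟨(a, b), Finset.mem_univ _⟩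
    fun p : V × V => G.dist p.1 p.2
  exact hdiamond.isoToConnectedInducedSubgraph (hp.symm.trans hdiam)
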